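/- Let m and n be positive integers and let x_1, x_2, x_3, … be real numbers. Then Σ_{λ ∈ P(n)} Σ_{j≥1} x_j · t_{jm}(λ) = Σ_{λ ∈ P(n)} Σ_{j≥1} x_j · ⌊t_1(λ)/(jm)⌋, where both outer sums run over all partitions λ of n. -/

import Mathlib

/-- Exchanging the sub-multiset of parts `s` of a partition for another multiset `u` of positive
integers with the same sum. -/
def Nat.Partition.exchange {n : ℕ} (p : n.Partition) (s u : Multiset ℕ) (h : s.sum = u.sum)
    (hu : ∀ i ∈ u, 0 < i) (hs : s ≤ p.parts) : n.Partition where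
  parts := p.parts - s + u
  parts_pos := by
    intro i hi
    rcases Multiset.mem_add.1 hi with hi | hi
    · exact p.parts_pos (Multiset.mem_of_le tsub_le_self hi)
    · exact hu i hi
  parts_sum := by
    rw [Multiset.sum_add, ← h, ← Multiset.sum_add, tsub_add_cancel_of_le hs, p.parts_sum]

/-- The number of partitions of `n` containing a given multiset of positive parts depends only on
the sum of that multiset. -/
theorem Nat.Partition.card_filter_le_parts {n : ℕ} {s u : Multiset ℕ} (h : s.sum = u.sum)
    (hs : ∀ i ∈ s, 0 < i) (hu : ∀ i ∈ u, 0 < i) :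
    (Finset.univ.filter fun p : n.Partition => s ≤ p.parts).card
      = (Finset.univ.filter fun p : n.Partition => u ≤ p.parts).card := by
  refine Finset.card_bij'
    (fun p hp => p.exchange s u h hu (Finset.mem_filter.1 hp).2)
    (fun p hp => p.exchange u s h.symm hs (Finset.mem_filter.1 hp).2) ?_ ?_ ?_ ?_
  · intro p hp
    simp [exchange]
  · intro p hp
    simp [exchange]
  · intro p hp
    ext1
    simp [exchange, tsub_add_cancel_of_le (Finset.mem_filter.1 hp).2]
  · intro p hp
    ext1
    simp [exchange, tsub_add_cancel_of_le (Finset.mem_filter.1 hp).2]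

theorem Finset.sum_eq_sum_card_filter_le {α : Type*} (s : Finset α) (f : α → ℕ) {n : ℕ}
    (hf : ∀ a ∈ s, f a ≤ n) :
    ∑ a ∈ s, f a = ∑ i ∈ Finset.Icc 1 n, (s.filter fun a => i ≤ f a).card := by
  simp_rw [Finset.card_filter]
  rw [Finset.sum_comm]
  refine Finset.sum_congr rfl fun a ha => ?_
  have hfilter : (Finset.Icc 1 n).filter (fun i => i ≤ f a) = Finset.Icc 1 (f a) := by
    ext i
    have := hf a ha
    simp only [Finset.mem_filter, Finset.mem_Icc]
    omega
  rw [← Finset.card_filter, hfilter, Nat.card_Icc, Nat.add_sub_cancel]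

theorem Nat.Partition.count_parts_le {n : ℕ} (p : n.Partition) (k : ℕ) : p.parts.count k ≤ n := by
  have hcard : p.parts.card • 1 ≤ p.parts.sum :=
    Multiset.card_nsmul_le_sum fun i hi => p.parts_pos hi
  have := Multiset.count_le_card k p.parts
  rw [p.parts_sum, smul_eq_mul, mul_one] at hcard
  exact this.trans hcard

theorem Nat.Partition.sum_count_eq_sum_count_one_div (n : ℕ) {k : ℕ} (hk : 0 < k) :
    ∑ p : n.Partition, p.parts.count k = ∑ p : n.Partition, p.parts.count 1 / k := by
  rw [Finset.sum_eq_sum_card_filter_le _ _ fun p _ => p.count_parts_le k,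
    Finset.sum_eq_sum_card_filter_le _ _ fun p _ =>
      (Nat.div_le_self _ k).trans (p.count_parts_le 1)]
  refine Finset.sum_congr rfl fun i _ => ?_
  simp_rw [Nat.le_div_iff_mul_le hk, Multiset.le_count_iff_replicate_le]
  refine card_filter_le_parts (by simp) ?_ ?_
  · intro j hj
    rwa [Multiset.eq_of_mem_replicate hj]
  · intro j hj
    rw [Multiset.eq_of_mem_replicate hj]
    exact Nat.one_pos


/-- For positive integers `m`, `n` and real numbers `x_1, x_2, …`:
`Σ_{λ ∈ P(n)} Σ_{j≥1} x_j t_{jm}(λ) = Σ_{λ ∈ P(n)} Σ_{j≥1} x_j ⌊t_1(λ)/(jm)⌋`.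
All terms with `jm > n` vanish, so the inner sums may be taken over `1 ≤ j ≤ n`. -/
theorem stmt_15 (m n : ℕ) (hm : 0 < m) (hn : 0 < n) (x : ℕ → ℝ) :
    ∑ p : Nat.Partition n, ∑ j ∈ Finset.Icc 1 n, x j * (p.parts.count (j * m) : ℝ)
      = ∑ p : Nat.Partition n,
          ∑ j ∈ Finset.Icc 1 n, x j * ((p.parts.count 1 / (j * m) : ℕ) : ℝ) := by
  rw [Finset.sum_comm, Finset.sum_comm (s := Finset.univ)]
  refine Finset.sum_congr rfl fun j hj => ?_
  have hjm : 0 < j * m := Nat.mul_pos (Finset.mem_Icc.1 hj).1 hm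
  rw [← Finset.mul_sum, ← Finset.mul_sum, ← Nat.cast_sum, ← Nat.cast_sum,
    Nat.Partition.sum_count_eq_sum_count_one_div n hjm]
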